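/- Let E be a real inner product space, S ⊆ E, θ_k ∈ S, g ∈ E, and η > 0. Suppose v ∈ S satisfies ⟨(θ_k + η·g) − v, w − v⟩ ≤ 0 for all w ∈ S, and set ρ = (v − θ_k)/η. Then for every θ ∈ S, ⟨g, θ − θ_k⟩ ≤ ‖ρ‖₂ · (‖θ − θ_k‖₂ + η·‖g‖₂). -/

import Mathlib

open scoped RealInnerProductSpace

/-- **Gradient-mapping bound on deviation from stationarity.**
If `v ∈ S` satisfies the variational inequality characterizing the projection of
`θ_k + η • g` onto `S` and `ρ = (v − θ_k)/η` is the gradient mapping, then for every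
`θ ∈ S`, `⟪g, θ − θ_k⟫ ≤ ‖ρ‖₂ (‖θ − θ_k‖₂ + η ‖g‖₂)`. -/
theorem stmt_10 {E : Type*} [NormedAddCommGroup E] [InnerProductSpace ℝ E]
    (S : Set E) (θk g v : E) (η : ℝ) (hη : 0 < η) (hθk : θk ∈ S) (hv : v ∈ S)
    (hvar : ∀ w ∈ S, ⟪(θk + η • g) - v, w - v⟫ ≤ 0) :
    ∀ θ ∈ S, ⟪g, θ - θk⟫ ≤ ‖(1 / η) • (v - θk)‖ * (‖θ - θk‖ + η * ‖g‖) := by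
  intro θ hθ
  have h := hvar θ hθ
  obtain ⟨r, hr⟩ : ∃ r, r = (1 / η) • (v - θk) := ⟨_, rfl⟩
  obtain ⟨d, hd⟩ : ∃ d, d = θ - θk := ⟨_, rfl⟩
  have hvr : v = θk + η • r := by
    rw [hr, smul_smul, mul_one_div_cancel hη.ne', one_smul]
    abel
  have e1 : (θk + η • g) - v = η • (g - r) := by
    rw [hvr, smul_sub]
    abel
  have e2 : θ - v = d - η • r := by
    rw [hvr, hd]
    abel
  rw [e1, e2, real_inner_smul_left] at h
  have h2 : ⟪g - r, d - η • r⟫ ≤ 0 := by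
    by_contra hc
    push Not at hc
    exact absurd (mul_pos hη hc) (not_lt.mpr h)
  rw [inner_sub_left, inner_sub_right, inner_sub_right, real_inner_smul_right,
    real_inner_smul_right] at h2
  rw [← hr, ← hd]
  have a1 := real_inner_le_norm r d
  have a2 := mul_le_mul_of_nonneg_left (real_inner_le_norm g r) hη.le
  have a3 : 0 ≤ η * ⟪r, r⟫ := mul_nonneg hη.le real_inner_self_nonneg
  linarith
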